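/- Let Y ∈ ℝ^{n×p} have full column rank and let ξ ∈ ℝ^{n×p}. Then ξᵀY + Yᵀξ = 0 if and only if there exists a skew-symmetric matrix W ∈ ℝ^{n×n} (Wᵀ = −W) such that ξ = WY. That is, the tangent space of the layered manifold St_{YᵀY}(p,n) at Y admits the two parametrizations {ξ ∈ ℝ^{n×p} : ξᵀY + Yᵀξ = 0} = {WY : W ∈ ℝ^{n×n}, Wᵀ = −W}. -/

import Mathlib

open Matrix BigOperators

noncomputable section

/-- A real matrix of full column rank has a left inverse. -/
theorem Matrix.exists_left_inverse_of_rank_eq {n p : ℕ}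
    (Y : Matrix (Fin n) (Fin p) ℝ) (hY : Y.rank = p) :
    ∃ L : Matrix (Fin p) (Fin n) ℝ, L * Y = 1 := by
  have hker : LinearMap.ker Y.mulVecLin = ⊥ := by
    rw [← Submodule.finrank_eq_zero (R := ℝ)]
    have h := Y.mulVecLin.finrank_range_add_finrank_ker
    rw [Module.finrank_fin_fun] at h
    change Y.rank + _ = p at h
    omega
  obtain ⟨g, hg⟩ := Y.mulVecLin.exists_leftInverse_of_injective hker
  refine ⟨LinearMap.toMatrix' g, ?_⟩
  rw [← LinearMap.toMatrix'_id, ← hg, LinearMap.toMatrix'_comp, ← Matrix.toLin'_apply',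
    LinearMap.toMatrix'_toLin']

/-- Two parametrizations of the tangent space of the layered manifold `St_{YᵀY}(p,n)` at a
full-column-rank `Y`: `ξᵀY + Yᵀξ = 0` iff `ξ = WY` for some skew-symmetric `W`. -/
theorem tangent_space_parametrizations {n p : ℕ}
    (Y : Matrix (Fin n) (Fin p) ℝ) (hY : Y.rank = p)
    (ξ : Matrix (Fin n) (Fin p) ℝ) :
    ξᵀ * Y + Yᵀ * ξ = 0 ↔ ∃ W : Matrix (Fin n) (Fin n) ℝ, Wᵀ = -W ∧ ξ = W * Y := by
  constructor
  · intro h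
    obtain ⟨L, hL⟩ := Matrix.exists_left_inverse_of_rank_eq Y hY
    have h' : Yᵀ * ξ = -(ξᵀ * Y) := eq_neg_of_add_eq_zero_right h
    refine ⟨ξ * L - Lᵀ * ξᵀ + Lᵀ * (ξᵀ * Y) * L, ?_, ?_⟩
    · simp only [transpose_add, transpose_sub, transpose_mul, transpose_transpose, h',
        Matrix.neg_mul, Matrix.mul_neg, Matrix.mul_assoc]
      abel
    · simp only [Matrix.add_mul, Matrix.sub_mul, Matrix.mul_assoc, hL, Matrix.mul_one]
      abel
  · rintro ⟨W, hW, rfl⟩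
    simp [transpose_mul, hW, Matrix.mul_assoc]
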